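/- For every integer t ≥ 5, there exist a constant c = c(t) > 0 and an n_0 such that for all n ≥ n_0, both C_3(n, SP_t^1) ≥ c · n^{1/3} and C_3(n, SP_t^2) ≥ c · n^{1/3}. -/

import Mathlib

open Finset

/-- A hypergraph on a finite set of natural-number vertices. -/
structure HGraph where
  verts : Finset ℕ
  edges : Finset (Finset ℕ)

/-- `H` is an `r`-uniform hypergraph. -/
def HGraph.IsUniform (H : HGraph) (r : ℕ) : Prop :=
  ∀ e ∈ H.edges, e ⊆ H.verts ∧ e.card = r

/-- `φ` determines a copy of `H` in the complete hypergraph on vertex set `range n`. -/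
def IsCopy (n : ℕ) (H : HGraph) (φ : ℕ → ℕ) : Prop :=
  Set.InjOn φ ↑H.verts ∧ ∀ v ∈ H.verts, φ v ∈ Finset.range n

/-- The family of edge-colourings `f v` with `k` colours is an `(n,r,H)`-local colouring:
for every copy of `H` there is a vertex of the copy whose colouring is rainbow on it. -/
def IsLocalColoring (n k : ℕ) (H : HGraph) (f : ℕ → Finset ℕ → Fin k) : Prop :=
  ∀ φ : ℕ → ℕ, IsCopy n H φ →
    ∃ x ∈ H.verts, ∀ e₁ ∈ H.edges, ∀ e₂ ∈ H.edges,
      f (φ x) (e₁.image φ) = f (φ x) (e₂.image φ) → e₁ = e₂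

/-- The local rainbow colouring number `C_r(n,H)`:
the least number of colours admitting an `(n,r,H)`-local colouring. -/
noncomputable def localC (n : ℕ) (H : HGraph) : ℕ :=
  sInf {k | ∃ f : ℕ → Finset ℕ → Fin k, IsLocalColoring n k H f}

/-- Starting vertex of the `j`-th edge of `SP_t^1`. -/
def sp1start (j : ℕ) : ℕ := if j % 2 = 1 then 3 * (j - 1) / 2 + 1 else 3 * j / 2

/-- The special path `SP_t^1` on vertex set `{1, …, ⌈(3t+3)/2⌉}`: consecutive edges
alternately share one vertex and two vertices, beginning with an overlap of one vertex. -/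
def SP1 (t : ℕ) : HGraph :=
  ⟨Finset.Icc 1 ((3 * t + 4) / 2),
   (Finset.Icc 1 t).image fun j => {sp1start j, sp1start j + 1, sp1start j + 2}⟩

/-- Starting vertex of the `j`-th edge of `SP_t^2`. -/
def sp2start (j : ℕ) : ℕ := if j % 2 = 1 then 3 * (j - 1) / 2 + 1 else (3 * j - 2) / 2

/-- The special path `SP_t^2` on vertex set `{1, …, ⌈(3t+2)/2⌉}`: consecutive edges
alternately share two vertices and one vertex, beginning with an overlap of two vertices. -/
def SP2 (t : ℕ) : HGraph :=
  ⟨Finset.Icc 1 ((3 * t + 3) / 2),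
   (Finset.Icc 1 t).image fun j => {sp2start j, sp2start j + 1, sp2start j + 2}⟩

/-- Among `2k` points coloured with `k` colours at least `2k` ordered pairs of distinct points
are monochromatic. -/
theorem two_mul_le_card_monochromatic_offDiag {α : Type*} [DecidableEq α] {k : ℕ} (hk : 0 < k)
    (X : Finset α) (hX : X.card = 2 * k) (g : α → Fin k) :
    2 * k ≤ (X.offDiag.filter fun p => g p.1 = g p.2).card := by
  have hsum : ∑ i : Fin k, (X.filter fun x => g x = i).card = 2 * k := by
    rw [← hX, Finset.card_eq_sum_card_fiberwise (f := g) (t := Finset.univ) (by simp)]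
  have hcs := sq_sum_le_card_mul_sum_sq (s := (Finset.univ : Finset (Fin k)))
    (f := fun i => (X.filter fun x => g x = i).card)
  rw [hsum, Finset.card_univ, Fintype.card_fin] at hcs
  have hsq : ∑ i : Fin k, (X.filter fun x => g x = i).card ^ 2
      = ((X ×ˢ X).filter fun p => g p.1 = g p.2).card := by
    rw [Finset.card_eq_sum_card_fiberwise (f := fun p => g p.1) (t := Finset.univ) (by simp)]
    refine Finset.sum_congr rfl fun i _ => ?_
    rw [sq, ← Finset.card_product]
    congr 1
    ext p
    simp only [Finset.mem_product, Finset.mem_filter]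
    grind
  have hsplit : ((X ×ˢ X).filter fun p => g p.1 = g p.2)
      ⊆ (X.offDiag.filter fun p => g p.1 = g p.2) ∪ X.diag := by
    intro p hp
    simp only [Finset.mem_product, Finset.mem_filter, Finset.mem_union, Finset.mem_offDiag,
      Finset.mem_diag] at hp ⊢
    grind
  have hle := (Finset.card_le_card hsplit).trans (Finset.card_union_le _ _)
  rw [Finset.diag_card, hX, ← hsq] at hle
  nlinarith

/-- If every point of `A` colours the `2k` points of `X` with `k` colours, then some pair of
distinct points of `X` is monochromatic for a proportion `1 / (2k)` of `A`. -/
theorem exists_pair_card_le_mul_card_monochromatic {α β : Type*} [DecidableEq α] {k : ℕ}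
    (hk : 0 < k) (A : Finset β) (X : Finset α) (hX : X.card = 2 * k) (g : β → α → Fin k) :
    ∃ x ∈ X, ∃ y ∈ X, x ≠ y ∧ A.card ≤ 2 * k * (A.filter fun u => g u x = g u y).card := by
  by_contra! h
  have hcount : A.card * (2 * k)
      ≤ ∑ p ∈ X.offDiag, (A.filter fun u => g u p.1 = g u p.2).card := by
    have hswap := Finset.sum_card_bipartiteAbove_eq_sum_card_bipartiteBelow
      (s := A) (t := X.offDiag) (fun u p => g u p.1 = g u p.2)
    simp only [Finset.bipartiteAbove, Finset.bipartiteBelow] at hswap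
    rw [← hswap, ← smul_eq_mul]
    exact Finset.card_nsmul_le_sum _ _ _ fun u _ =>
      two_mul_le_card_monochromatic_offDiag hk X hX (g u)
  have hne : X.offDiag.Nonempty := by
    rw [← Finset.card_pos, Finset.offDiag_card, hX]
    have : 2 * k * 1 < 2 * k * (2 * k) := Nat.mul_lt_mul_of_pos_left (by omega) (by omega)
    omega
  have hlt : ∑ p ∈ X.offDiag, 2 * k * (A.filter fun u => g u p.1 = g u p.2).card
      < ∑ p ∈ X.offDiag, A.card := by
    refine Finset.sum_lt_sum_of_nonempty hne fun p hp => ?_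
    rw [Finset.mem_offDiag] at hp
    exact h _ hp.1 _ hp.2.1 hp.2.2
  rw [← Finset.mul_sum, Finset.sum_const, Finset.offDiag_card, hX, smul_eq_mul] at hlt
  have h1 : (2 * k * (2 * k) - 2 * k) * A.card ≤ 2 * k * (2 * k) * A.card :=
    Nat.mul_le_mul_right _ (Nat.sub_le _ _)
  have h2 := Nat.mul_le_mul_left (2 * k) hcount
  linarith

theorem exists_injOn_range_mapsTo {α : Type*} [Inhabited α] (A : Finset α) :
    ∃ w : ℕ → α, Set.InjOn w (Set.Iio A.card) ∧ ∀ i < A.card, w i ∈ A := by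
  refine ⟨fun i => if h : i < A.card then (A.equivFin.symm ⟨i, h⟩ : α) else default, ?_, ?_⟩
  · intro a ha b hb hab
    simp only [Set.mem_Iio] at ha hb
    simp only [ha, hb, dif_pos] at hab
    simpa using A.equivFin.symm.injective (Subtype.ext hab)
  · intro i hi
    simp [hi]

theorem injOn_ite_of_injOn {α : Type*} {s : Set ℕ} {g : ℕ → α} (hg : Set.InjOn g s) {a b c d : α}
    (hab : a ≠ b) (hac : a ≠ c) (had : a ≠ d) (hbc : b ≠ c) (hbd : b ≠ d) (hcd : c ≠ d)
    (hne : ∀ v ∈ s, g v ≠ a ∧ g v ≠ b ∧ g v ≠ c ∧ g v ≠ d) :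
    Set.InjOn (fun v => if v = 6 then a else if v = 7 then b else if v = 8 then c else
      if v = 9 then d else g v) s := by
  intro u hu v hv huv
  have hu' := hne u hu
  have hv' := hne v hv
  have hguv := fun h => hg hu hv h
  dsimp only at huv
  grind

/-- When `n` is large compared with `k ^ 3`, every family of `k`-colourings of triples admits an
injection of `{1, …, m}` for which no colouring at a vertex of the image is rainbow on the images
of `123`, `345`, `678` and `789`. -/
theorem exists_injOn_not_rainbow {n k m : ℕ} (hk : 0 < k) (hn : (20 + 2 * m) * k ^ 3 ≤ n)
    (f : ℕ → Finset ℕ → Fin k) :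
    ∃ φ : ℕ → ℕ, Set.InjOn φ (Set.Icc 1 m) ∧ (∀ v ∈ Set.Icc 1 m, φ v < n) ∧
      ∀ v ∈ Set.Icc 1 m,
        f (φ v) {φ 6, φ 7, φ 8} = f (φ v) {φ 7, φ 8, φ 9} ∨
        f (φ v) {φ 1, φ 2, φ 3} = f (φ v) {φ 3, φ 4, φ 5} := by
  have hk3 : k ≤ k ^ 3 := Nat.le_self_pow (by norm_num) k
  have hmk : m * k ≤ m * k ^ 3 := Nat.mul_le_mul_left m hk3
  obtain ⟨c, -, hc⟩ : ∃ c ∈ (Finset.univ : Finset (Fin k × Fin k)),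
      2 * k ≤ ((Finset.Ico 2 n).filter fun v => (f 0 {v, 0, 1}, f 1 {v, 0, 1}) = c).card := by
    refine Finset.exists_le_card_fiber_of_mul_le_card_of_maps_to (by simp)
      ⟨(⟨0, hk⟩, ⟨0, hk⟩), by simp⟩ ?_
    simp only [Finset.card_univ, Fintype.card_prod, Fintype.card_fin, Nat.card_Ico]
    have : k * k * (2 * k) = 2 * k ^ 3 := by ring
    have : (20 + 2 * m) * k ^ 3 = 20 * k ^ 3 + 2 * (m * k ^ 3) := by ring
    omega
  obtain ⟨X, hXc, hX⟩ := Finset.exists_subset_card_eq hc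
  obtain ⟨x, hx, y, hy, hxy, hU⟩ := exists_pair_card_le_mul_card_monochromatic hk
    (Finset.range n) X hX fun u v => f u {v, 0, 1}
  have hx' := hXc hx
  have hy' := hXc hy
  simp only [Finset.mem_filter, Finset.mem_Ico] at hx' hy'
  set U := (Finset.range n).filter fun u => f u {x, 0, 1} = f u {y, 0, 1} with hUdef
  have hUcard : 2 * k ^ 2 + 8 + m ≤ U.card := by
    rw [Finset.card_range] at hU
    have h1 : 2 * k * (2 * k ^ 2 + 8 + m) ≤ 2 * k * U.card := by nlinarith
    exact Nat.le_of_mul_le_mul_left h1 (by omega)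
  set U' := U \ {0, 1, x, y} with hU'def
  have hU'card : 2 * k ^ 2 + 4 + m ≤ U'.card := by
    have h1 : U.card - ({0, 1, x, y} : Finset ℕ).card ≤ U'.card := Finset.le_card_sdiff _ _
    have h2 : ({0, 1, x, y} : Finset ℕ).card ≤ 4 := Finset.card_le_four
    omega
  obtain ⟨w, hwinj, hwmem⟩ := exists_injOn_range_mapsTo U'
  obtain ⟨i, hi, j, hj, hij, hcol⟩ : ∃ i ∈ Finset.range (k ^ 2 + 1),
      ∃ j ∈ Finset.range (k ^ 2 + 1), i ≠ j ∧
        (f x {w (2 * i + 1), w (2 * i + 2), w 0}, f y {w (2 * i + 1), w (2 * i + 2), w 0})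
        = (f x {w (2 * j + 1), w (2 * j + 2), w 0}, f y {w (2 * j + 1), w (2 * j + 2), w 0}) :=
    Finset.exists_ne_map_eq_of_card_lt_of_maps_to
      (t := (Finset.univ : Finset (Fin k × Fin k))) (by simp [sq]) (by simp)
  rw [Prod.mk.injEq] at hcol
  simp only [Finset.mem_range] at hi hj
  have hw : ∀ l < 2 * k ^ 2 + 4 + m, w l < n ∧ f (w l) {x, 0, 1} = f (w l) {y, 0, 1} ∧
      w l ≠ 0 ∧ w l ≠ 1 ∧ w l ≠ x ∧ w l ≠ y := by
    intro l hl
    have := hwmem l (by omega)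
    simp only [hU'def, hUdef, Finset.mem_sdiff, Finset.mem_filter, Finset.mem_range,
      Finset.mem_insert, Finset.mem_singleton, not_or] at this
    tauto
  have hwne : ∀ a < 2 * k ^ 2 + 4 + m, ∀ b < 2 * k ^ 2 + 4 + m, w a = w b → a = b :=
    fun a ha b hb h => hwinj (show a < _ by omega) (show b < _ by omega) h
  set idx : ℕ → ℕ := fun v => if v = 1 then 2 * i + 1 else if v = 2 then 2 * i + 2 else
    if v = 3 then 0 else if v = 4 then 2 * j + 1 else if v = 5 then 2 * j + 2 else
    2 * k ^ 2 + 3 + v with hidx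
  have hidxlt : ∀ v ∈ Set.Icc 1 m, idx v < 2 * k ^ 2 + 4 + m := by
    rintro v ⟨h1, h2⟩
    simp only [hidx]
    split_ifs <;> omega
  have hidxinj : ∀ a ∈ Set.Icc 1 m, ∀ b ∈ Set.Icc 1 m, idx a = idx b → a = b := by
    rintro a ⟨-, -⟩ b ⟨-, -⟩ hab
    simp only [hidx] at hab
    split_ifs at hab <;> omega
  refine ⟨fun v => if v = 6 then x else if v = 7 then 0 else if v = 8 then 1 else
    if v = 9 then y else w (idx v), ?_, ?_, ?_⟩
  · refine injOn_ite_of_injOn (g := fun v => w (idx v))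
      (fun a ha b hb h => hidxinj a ha b hb (hwne _ (hidxlt a ha) _ (hidxlt b hb) h))
      (by omega) (by omega) hxy (by omega) (by omega) (by omega) fun v hv => ?_
    obtain ⟨-, -, h0, h1, h2, h3⟩ := hw _ (hidxlt v hv)
    exact ⟨h2, h0, h1, h3⟩
  · intro v hv
    have := (hw _ (hidxlt v hv)).1
    dsimp only
    split_ifs <;> omega
  · intro v hv
    have hperm : ∀ z : ℕ, ({0, 1, z} : Finset ℕ) = {z, 0, 1} := by
      intro z; ext; simp; tauto
    have hperm' : ∀ p q r : ℕ, ({r, p, q} : Finset ℕ) = {p, q, r} := by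
      intro p q r; ext; simp; tauto
    have h01 : f 0 {x, 0, 1} = f 0 {y, 0, 1} ∧ f 1 {x, 0, 1} = f 1 {y, 0, 1} := by
      have := hx'.2.trans hy'.2.symm
      rwa [Prod.mk.injEq] at this
    have hwv := (hw _ (hidxlt v hv)).2.1
    have hgood : f x {w (idx 1), w (idx 2), w (idx 3)} = f x {w (idx 3), w (idx 4), w (idx 5)} ∧
        f y {w (idx 1), w (idx 2), w (idx 3)} = f y {w (idx 3), w (idx 4), w (idx 5)} := by
      rw [hperm' (w (idx 4))]
      simpa [hidx] using hcol
    simp only [Nat.reduceEqDiff, if_true, if_false, hperm]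
    split_ifs
    exacts [Or.inr hgood.1, Or.inl h01.1, Or.inl h01.2, Or.inr hgood.2, Or.inl hwv]

theorem exists_isLocalColoring (n : ℕ) (H : HGraph) (hne : H.verts.Nonempty)
    (hH : ∀ e ∈ H.edges, e ⊆ H.verts) :
    ∃ k, ∃ f : ℕ → Finset ℕ → Fin k, IsLocalColoring n k H f := by
  refine ⟨_, fun _ e => (Finset.range n).powerset.equivFin
    ⟨e ∩ Finset.range n, Finset.mem_powerset.2 Finset.inter_subset_right⟩, ?_⟩
  rintro φ ⟨hinj, hmem⟩
  obtain ⟨x, hx⟩ := hne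
  refine ⟨x, hx, fun e₁ h₁ e₂ h₂ h => ?_⟩
  have hsub : ∀ e ∈ H.edges, e.image φ ∩ Finset.range n = e.image φ := fun e he =>
    Finset.inter_eq_left.2 (Finset.image_subset_iff.2 fun v hv => hmem v (hH e he hv))
  have himage : e₁.image φ = e₂.image φ := by
    have := congrArg Subtype.val ((Finset.range n).powerset.equivFin.injective h)
    simpa only [hsub _ h₁, hsub _ h₂] using this
  have hset : φ '' (e₁ : Set ℕ) = φ '' (e₂ : Set ℕ) := by exact_mod_cast himage
  exact_mod_cast (hinj.image_eq_image_iff (by exact_mod_cast hH _ h₁)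
    (by exact_mod_cast hH _ h₂)).1 hset

/-- The lower bound for any hypergraph containing, up to a relabelling `σ` of its vertices, the
edges `123`, `345`, `678` and `789`. -/
theorem mul_rpow_le_localC (n m : ℕ) (H : HGraph) (hm : 1 ≤ m) (hverts : H.verts = Finset.Icc 1 m)
    (hH : ∀ e ∈ H.edges, e ⊆ H.verts) (σ : ℕ → ℕ) (hσ : Function.Injective σ)
    (hσm : ∀ v ∈ Set.Icc 1 m, σ v ∈ Set.Icc 1 m)
    (hedge : ∀ s ∈ ({{1, 2, 3}, {3, 4, 5}, {6, 7, 8}, {7, 8, 9}} : Finset (Finset ℕ)),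
      ∃ e ∈ H.edges, e.image σ = s) :
    1 / (20 + 2 * m : ℝ) * (n : ℝ) ^ ((1 : ℝ) / 3) ≤ (localC n H : ℝ) := by
  obtain ⟨f, hf⟩ : ∃ f : ℕ → Finset ℕ → Fin (localC n H), IsLocalColoring n _ H f :=
    Nat.sInf_mem (exists_isLocalColoring n H (by rw [hverts]; simpa using hm) hH)
  generalize localC n H = k at f hf ⊢
  have hk : 0 < k := (f 0 ∅).pos
  have hlt : n < (20 + 2 * m) * k ^ 3 := by
    by_contra! hn
    obtain ⟨φ, hinj, hran, hφ⟩ := exists_injOn_not_rainbow hk hn f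
    have hcopy : IsCopy n H (φ ∘ σ) := by
      refine ⟨?_, fun v hv => ?_⟩
      · rw [hverts, Finset.coe_Icc]
        exact hinj.comp hσ.injOn hσm
      · rw [hverts, Finset.mem_Icc] at hv
        exact Finset.mem_range.2 (hran _ (hσm v hv))
    obtain ⟨x, hx, hrain⟩ := hf _ hcopy
    rw [hverts, Finset.mem_Icc] at hx
    obtain ⟨e₁, he₁, h₁⟩ := hedge {1, 2, 3} (by simp)
    obtain ⟨e₂, he₂, h₂⟩ := hedge {3, 4, 5} (by simp)
    obtain ⟨e₃, he₃, h₃⟩ := hedge {6, 7, 8} (by simp)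
    obtain ⟨e₄, he₄, h₄⟩ := hedge {7, 8, 9} (by simp)
    rcases hφ _ (hσm x hx) with h | h
    · have heq := hrain e₃ he₃ e₄ he₄ (by
        simpa [← Finset.image_image, h₃, h₄, Finset.image_insert] using h)
      rw [← heq, h₃] at h₄
      exact absurd h₄ (by decide)
    · have heq := hrain e₁ he₁ e₂ he₂ (by
        simpa [← Finset.image_image, h₁, h₂, Finset.image_insert] using h)
      rw [← heq, h₁] at h₂
      exact absurd h₂ (by decide)
  have hM : (1 : ℝ) ≤ 20 + 2 * m := by
    have : (0 : ℝ) ≤ m := Nat.cast_nonneg m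
    linarith
  have hle : (n : ℝ) ≤ ((20 + 2 * m) * k : ℝ) ^ (3 : ℕ) := by
    have h1 : (n : ℝ) ≤ (20 + 2 * m) * (k : ℝ) ^ 3 := by exact_mod_cast hlt.le
    rw [mul_pow]
    exact h1.trans (mul_le_mul_of_nonneg_right (le_self_pow₀ hM (by norm_num)) (by positivity))
  have hroot : (n : ℝ) ^ ((1 : ℝ) / 3) ≤ (20 + 2 * m) * k := by
    calc (n : ℝ) ^ ((1 : ℝ) / 3)
        ≤ (((20 + 2 * m) * k : ℝ) ^ (3 : ℕ)) ^ ((1 : ℝ) / 3) :=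
          Real.rpow_le_rpow (Nat.cast_nonneg n) hle (by norm_num)
      _ = (20 + 2 * m) * k := by
          rw [← Real.rpow_natCast, ← Real.rpow_mul (by positivity)]
          norm_num
  rw [one_div, inv_mul_le_iff₀ (by linarith)]
  exact hroot

theorem SP1_edges_subset_verts (t : ℕ) : ∀ e ∈ (SP1 t).edges, e ⊆ (SP1 t).verts := by
  intro e he v hv
  simp only [SP1, Finset.mem_image, Finset.mem_Icc] at he ⊢
  obtain ⟨j, hj, rfl⟩ := he
  simp only [sp1start, Finset.mem_insert, Finset.mem_singleton] at hv
  split_ifs at hv <;> omega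

theorem SP2_edges_subset_verts (t : ℕ) : ∀ e ∈ (SP2 t).edges, e ⊆ (SP2 t).verts := by
  intro e he v hv
  simp only [SP2, Finset.mem_image, Finset.mem_Icc] at he ⊢
  obtain ⟨j, hj, rfl⟩ := he
  simp only [sp2start, Finset.mem_insert, Finset.mem_singleton] at hv
  split_ifs at hv <;> omega

theorem mul_rpow_le_localC_SP1 (n t : ℕ) (ht : 5 ≤ t) :
    1 / (20 + 2 * ((3 * t + 4) / 2 : ℕ) : ℝ) * (n : ℝ) ^ ((1 : ℝ) / 3)
      ≤ (localC n (SP1 t) : ℝ) := by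
  refine mul_rpow_le_localC n _ (SP1 t) (by omega) rfl (SP1_edges_subset_verts t) id
    Function.injective_id (fun _ h => h) fun s hs => ⟨s, ?_, Finset.image_id⟩
  simp only [Finset.mem_insert, Finset.mem_singleton] at hs
  simp only [SP1, Finset.mem_image, Finset.mem_Icc]
  rcases hs with rfl | rfl | rfl | rfl
  exacts [⟨1, by omega, rfl⟩, ⟨2, by omega, rfl⟩, ⟨4, by omega, rfl⟩, ⟨5, by omega, rfl⟩]

theorem mul_rpow_le_localC_SP2 (n t : ℕ) (ht : 5 ≤ t) :
    1 / (20 + 2 * ((3 * t + 3) / 2 : ℕ) : ℝ) * (n : ℝ) ^ ((1 : ℝ) / 3)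
      ≤ (localC n (SP2 t) : ℝ) := by
  refine mul_rpow_le_localC n _ (SP2 t) (by omega) rfl (SP2_edges_subset_verts t)
    (fun v => if 1 ≤ v ∧ v ≤ 9 then 10 - v else v) ?_ ?_ fun s hs => ?_
  · intro a b hab
    dsimp only at hab
    split_ifs at hab <;> omega
  · rintro v ⟨h1, h2⟩
    rw [Set.mem_Icc]
    split_ifs <;> omega
  · simp only [Finset.mem_insert, Finset.mem_singleton] at hs
    simp only [SP2, Finset.exists_mem_image, Finset.mem_Icc]
    rcases hs with rfl | rfl | rfl | rfl
    exacts [⟨5, by omega, by decide⟩, ⟨4, by omega, by decide⟩, ⟨2, by omega, by decide⟩,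
      ⟨1, by omega, by decide⟩]

theorem stmt_12 (t : ℕ) (ht : 5 ≤ t) :
    ∃ c : ℝ, 0 < c ∧ ∃ n₀ : ℕ, ∀ n : ℕ, n₀ ≤ n →
      c * (n : ℝ) ^ ((1 : ℝ) / 3) ≤ (localC n (SP1 t) : ℝ) ∧
      c * (n : ℝ) ^ ((1 : ℝ) / 3) ≤ (localC n (SP2 t) : ℝ) := by
  refine ⟨1 / (20 + 2 * ((3 * t + 4) / 2 : ℕ) : ℝ), by positivity, 0, fun n _ =>
    ⟨mul_rpow_le_localC_SP1 n t ht, le_trans ?_ (mul_rpow_le_localC_SP2 n t ht)⟩⟩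
  have : (3 * t + 3) / 2 ≤ (3 * t + 4) / 2 := by omega
  gcongr
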